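/- Let V be a quadratic stochastic operator on S^{m-1} that is both dissipative and Volterra. Then V is the identity operator on S^{m-1}. -/

import Mathlib

open Finset Filter Topology

/-- Membership in the simplex `S^{m-1}`. -/
def InSimplex {m : ℕ} (x : Fin m → ℝ) : Prop :=
  (∀ i, 0 ≤ x i) ∧ ∑ i, x i = 1

/-- The decreasing rearrangement `x↓` of a vector. -/
noncomputable def dsort {m : ℕ} (x : Fin m → ℝ) : Fin m → ℝ :=
  fun i => x (Tuple.sort x i.rev)

/-- The sum of the `k` largest coordinates of `x`. -/
noncomputable def topSum {m : ℕ} (x : Fin m → ℝ) (k : ℕ) : ℝ :=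
  ∑ i ∈ Finset.univ.filter (fun i : Fin m => (i : ℕ) < k), dsort x i

/-- `Maj x y` means `x ≺ y` : `x` is majorized by `y`. -/
def Maj {m : ℕ} (x y : Fin m → ℝ) : Prop :=
  (∀ k, 1 ≤ k → k ≤ m - 1 → topSum x k ≤ topSum y k) ∧ ∑ i, x i = ∑ i, y i

/-- The `k`-th vertex of the simplex. -/
def vertex {m : ℕ} (k : Fin m) : Fin m → ℝ := fun i => if i = k then 1 else 0

/-- The quadratic stochastic operator associated to coefficients `p`. -/
def qso {m : ℕ} (p : Fin m → Fin m → Fin m → ℝ) (x : Fin m → ℝ) : Fin m → ℝ :=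
  fun k => ∑ i, ∑ j, p i j k * x i * x j

/-- Conditions on the heredity coefficients of a q.s.o. -/
def IsQSO {m : ℕ} (p : Fin m → Fin m → Fin m → ℝ) : Prop :=
  (∀ i j k, 0 ≤ p i j k) ∧ (∀ i j k, p i j k = p j i k) ∧ (∀ i j, ∑ k, p i j k = 1)

theorem topSum_one {n : ℕ} (x : Fin (n + 1) → ℝ) :
    topSum x 1 = x (Tuple.sort x (Fin.last n)) := by
  have h : Finset.univ.filter (fun i : Fin (n + 1) => (i : ℕ) < 1) = {0} := by
    ext i
    rw [Finset.mem_filter_univ, Finset.mem_singleton, Fin.ext_iff, Fin.val_zero, Nat.lt_one_iff]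
  rw [topSum, h, Finset.sum_singleton, dsort, Fin.rev_zero]

theorem le_topSum_one {n : ℕ} (x : Fin (n + 1) → ℝ) (i : Fin (n + 1)) :
    x i ≤ topSum x 1 := by
  rw [topSum_one]
  have h := Tuple.monotone_sort x (Fin.le_last ((Tuple.sort x).symm i))
  simpa using h

theorem Maj.exists_le {m : ℕ} (hm : 2 ≤ m) {x y : Fin m → ℝ} (h : Maj x y) (i : Fin m) :
    ∃ l, x i ≤ y l := by
  obtain ⟨n, rfl⟩ : ∃ n, m = n + 1 := ⟨m - 1, by omega⟩
  refine ⟨Tuple.sort y (Fin.last n), ?_⟩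
  rw [← topSum_one y]
  exact (le_topSum_one x i).trans (h.1 1 le_rfl (by omega))

/-- The point of the edge between the vertices `i` and `j` with weights `3/4` and `1/4`. -/
noncomputable def edgePoint {m : ℕ} (i j : Fin m) : Fin m → ℝ :=
  fun k => 3 / 4 * vertex i k + 1 / 4 * vertex j k

theorem sum_mul_edgePoint {m : ℕ} (i j : Fin m) (c : Fin m → ℝ) :
    ∑ k, c k * edgePoint i j k = c i * (3 / 4) + c j * (1 / 4) := by
  simp [edgePoint, vertex, mul_add, Finset.sum_add_distrib]

theorem inSimplex_edgePoint {m : ℕ} (i j : Fin m) : InSimplex (edgePoint i j) := by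
  refine ⟨fun k => ?_, ?_⟩
  · unfold edgePoint vertex
    positivity
  · have h := sum_mul_edgePoint i j (fun _ => 1)
    norm_num at h
    exact h

theorem qso_edgePoint {m : ℕ} (p : Fin m → Fin m → Fin m → ℝ) (i j l : Fin m) :
    qso p (edgePoint i j) l =
      9 / 16 * p i i l + 3 / 16 * p i j l + 3 / 16 * p j i l + 1 / 16 * p j j l := by
  have h (a : Fin m) : ∑ b, p a b l * edgePoint i j a * edgePoint i j b =
      (p a i l * (3 / 4) + p a j l * (1 / 4)) * edgePoint i j a := by
    rw [sum_mul_edgePoint i j (fun b => p a b l * edgePoint i j a)]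
    ring
  simp only [qso, h]
  rw [sum_mul_edgePoint i j (fun a => p a i l * (3 / 4) + p a j l * (1 / 4))]
  ring

theorem volterra_diag {m : ℕ} {p : Fin m → Fin m → Fin m → ℝ} (hp : IsQSO p)
    (hV : ∀ i j k, k ≠ i → k ≠ j → p i j k = 0) (i : Fin m) : p i i i = 1 := by
  rw [← hp.2.2 i i, Finset.sum_eq_single i (fun k _ hk => hV i i k hk hk) (by simp)]

theorem volterra_add {m : ℕ} {p : Fin m → Fin m → Fin m → ℝ} (hp : IsQSO p)
    (hV : ∀ i j k, k ≠ i → k ≠ j → p i j k = 0) {i j : Fin m} (hij : i ≠ j) :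
    p i j i + p i j j = 1 := by
  rw [← hp.2.2 i j, Finset.sum_eq_add_of_mem i j (by simp) (by simp) hij
    (fun k _ hk => hV i j k hk.1 hk.2)]

theorem half_le_of_dissipative {m : ℕ} {p : Fin m → Fin m → Fin m → ℝ} (hp : IsQSO p)
    (hV : ∀ i j k, k ≠ i → k ≠ j → p i j k = 0)
    (hdiss : ∀ x, InSimplex x → Maj x (qso p x)) {i j : Fin m} (hij : i ≠ j) :
    1 / 2 ≤ p i j i := by
  have hm : 2 ≤ m := by omega
  obtain ⟨l, hl⟩ := (hdiss _ (inSimplex_edgePoint i j)).exists_le hm i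
  have hx : edgePoint i j i = 3 / 4 := by simp [edgePoint, vertex, hij]
  rw [hx, qso_edgePoint, hp.2.1 j i l] at hl
  have hadd := volterra_add hp hV hij
  have hnonneg := hp.1 i j i
  by_cases hli : l = i
  · subst hli
    rw [volterra_diag hp hV, hV j j l hij hij] at hl
    linarith
  by_cases hlj : l = j
  · subst hlj
    rw [volterra_diag hp hV, hV i i l hli hli] at hl
    linarith
  · rw [hV i i l hli hli, hV i j l hli hlj, hV j j l hlj hlj] at hl
    norm_num at hl

theorem coeff_eq_of_dissipative {m : ℕ} {p : Fin m → Fin m → Fin m → ℝ} (hp : IsQSO p)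
    (hV : ∀ i j k, k ≠ i → k ≠ j → p i j k = 0)
    (hdiss : ∀ x, InSimplex x → Maj x (qso p x)) (i j k : Fin m) :
    p i j k = ((if i = k then 1 else 0) + (if j = k then 1 else 0)) / 2 := by
  by_cases hij : i = j
  · subst hij
    by_cases hik : i = k
    · subst hik
      simp [volterra_diag hp hV]
    · simp [hik, hV i i k (Ne.symm hik) (Ne.symm hik)]
  · have h₁ := half_le_of_dissipative hp hV hdiss hij
    have h₂ := half_le_of_dissipative hp hV hdiss (Ne.symm hij)
    rw [hp.2.1] at h₂
    have hadd := volterra_add hp hV hij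
    by_cases hik : i = k
    · subst hik
      rw [if_pos rfl, if_neg (Ne.symm hij)]
      linarith
    by_cases hjk : j = k
    · subst hjk
      rw [if_pos rfl, if_neg hij]
      linarith
    · simp [hik, hjk, hV i j k (Ne.symm hik) (Ne.symm hjk)]

theorem stmt13 (m : ℕ) (p : Fin m → Fin m → Fin m → ℝ) (hp : IsQSO p)
    (hVolterra : ∀ i j k, k ≠ i → k ≠ j → p i j k = 0)
    (hdiss : ∀ x, InSimplex x → Maj x (qso p x)) :
    ∀ x, InSimplex x → qso p x = x := by
  intro x hx
  funext k
  have h (i j : Fin m) : p i j k * x i * x j =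
      (if i = k then x i else 0) * x j / 2 + x i * (if j = k then x j else 0) / 2 := by
    rw [coeff_eq_of_dissipative hp hVolterra hdiss]
    split_ifs <;> ring
  simp only [qso, h, Finset.sum_add_distrib, ← Finset.sum_div, ← Finset.mul_sum,
    ← Finset.sum_mul, hx.2, Finset.sum_ite_eq', Finset.mem_univ, if_true]
  ring
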